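/- Let X be a real-valued random variable whose moment-generating function exists, i.e., there is δ > 0 such that E[e^{tX}] < ∞ for all t ∈ (−δ, δ). Then the polynomial MMSE converges to the MMSE uniformly in the signal-to-noise ratio: sup_{t ≥ 0} (pmmse_n(X, t) − mmse(X, t)) → 0 as n → ∞. -/

import Mathlib

open MeasureTheory ProbabilityTheory Filter

/-- The `n`-th polynomial minimum mean-square error of estimating `X` from `Y`. -/
noncomputable def pmmse {Ω : Type*} [MeasurableSpace Ω] (P : Measure Ω)
    (X Y : Ω → ℝ) (n : ℕ) : ℝ :=
  ⨅ c : Fin (n + 1) → ℝ, ∫ ω, (X ω - ∑ j : Fin (n + 1), c j * Y ω ^ (j : ℕ)) ^ 2 ∂P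

/-- The minimum mean-square error `mmse(X|Y) = E[(X - E[X|Y])²]`. -/
noncomputable def mmse {Ω : Type*} [MeasurableSpace Ω] (P : Measure Ω)
    (X Y : Ω → ℝ) : ℝ :=
  ∫ ω, (X ω - (P[X | MeasurableSpace.comap Y Real.measurableSpace]) ω) ^ 2 ∂P

/-- `pmmse_n(X, t) = pmmse_n(X | √t·X + N)`. -/
noncomputable def pmmseAt {Ω : Type*} [MeasurableSpace Ω] (P : Measure Ω)
    (X N : Ω → ℝ) (n : ℕ) (t : ℝ) : ℝ :=
  pmmse P X (fun ω => Real.sqrt t * X ω + N ω) n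

/-- `mmse(X, t) = mmse(X | √t·X + N)`. -/
noncomputable def mmseAt {Ω : Type*} [MeasurableSpace Ω] (P : Measure Ω)
    (X N : Ω → ℝ) (t : ℝ) : ℝ :=
  mmse P X (fun ω => Real.sqrt t * X ω + N ω)

open scoped ENNReal NNReal Topology

/-- Finite measures on `ℝ` with moment-generating functions near `0` are determined by their
moments. -/
lemma Measure.ext_of_forall_integral_pow_eq {μ ν : Measure ℝ} [IsFiniteMeasure μ]
    [IsFiniteMeasure ν] (hμ : 0 ∈ interior (integrableExpSet id μ))
    (hν : 0 ∈ interior (integrableExpSet id ν))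
    (h : ∀ n : ℕ, ∫ x, x ^ n ∂μ = ∫ x, x ^ n ∂ν) : μ = ν := by
  have hμ0 := analyticAt_complexMGF (X := id) (μ := μ) (z := 0) (by simpa using hμ)
  have hν0 := analyticAt_complexMGF (X := id) (μ := ν) (z := 0) (by simpa using hν)
  have hder (n : ℕ) : iteratedDeriv n (complexMGF id μ) 0 = iteratedDeriv n (complexMGF id ν) 0 := by
    rw [iteratedDeriv_complexMGF (by simpa using hμ), iteratedDeriv_complexMGF (by simpa using hν)]
    have := congrArg (fun r : ℝ => (r : ℂ)) (h n)
    simp only [← integral_complex_ofReal] at this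
    simpa using this
  have hev : complexMGF id μ =ᶠ[𝓝 0] complexMGF id ν := by
    have h1 := hμ0.hasFPowerSeriesAt
    have h2 := hν0.hasFPowerSeriesAt
    simp only [hder] at h1
    have h3 := h1.sub h2
    rw [sub_self] at h3
    filter_upwards [h3.eventually_eq_zero] with z hz
    exact sub_eq_zero.1 hz
  set U : Set ℝ := interior (integrableExpSet id μ) ∩ interior (integrableExpSet id ν)
  have hconv : Convex ℝ U := convex_integrableExpSet.interior.inter convex_integrableExpSet.interior
  have heq : Set.EqOn (complexMGF id μ) (complexMGF id ν) {z | z.re ∈ U} := by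
    refine AnalyticOnNhd.eqOn_of_preconnected_of_eventuallyEq (z₀ := 0)
      (analyticOnNhd_complexMGF.mono fun z hz => hz.1)
      (analyticOnNhd_complexMGF.mono fun z hz => hz.2)
      (hconv.linear_preimage Complex.reLm).isPreconnected ⟨by simpa using hμ, by simpa using hν⟩ hev
  refine Measure.ext_of_charFun (funext fun t => ?_)
  rw [← complexMGF_id_mul_I, ← complexMGF_id_mul_I]
  exact heq ⟨by simpa using hμ, by simpa using hν⟩

lemma zero_mem_interior_integrableExpSet {Ω : Type*} [MeasurableSpace Ω] {μ : Measure Ω}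
    {X : Ω → ℝ} {δ : ℝ} (hδ : 0 < δ)
    (h : ∀ t ∈ Set.Ioo (-δ) δ, Integrable (fun ω => Real.exp (t * X ω)) μ) :
    0 ∈ interior (integrableExpSet X μ) :=
  mem_interior_iff_mem_nhds.2 <| mem_of_superset (Ioo_mem_nhds (by linarith) hδ) h

lemma exists_of_zero_mem_interior_integrableExpSet {Ω : Type*} [MeasurableSpace Ω]
    {μ : Measure Ω} {X : Ω → ℝ} (h : 0 ∈ interior (integrableExpSet X μ)) :
    ∃ δ : ℝ, 0 < δ ∧ ∀ t ∈ Set.Ioo (-δ) δ, Integrable (fun ω => Real.exp (t * X ω)) μ := by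
  obtain ⟨δ, hδ, h⟩ := Metric.mem_nhds_iff.1 (mem_interior_iff_mem_nhds.1 h)
  refine ⟨δ, hδ, fun t ht => h ?_⟩
  rw [Real.ball_eq_Ioo]; simpa using ht

lemma zero_mem_interior_integrableExpSet_withDensity {ν : Measure ℝ} [IsFiniteMeasure ν]
    (hν : 0 ∈ interior (integrableExpSet id ν)) {f : ℝ → ℝ} (hf : MemLp f 2 ν) :
    0 ∈ interior (integrableExpSet id (ν.withDensity fun x => ENNReal.ofReal (f x))) := by
  obtain ⟨δ, hδ, h⟩ := exists_of_zero_mem_interior_integrableExpSet hν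
  refine zero_mem_interior_integrableExpSet (half_pos hδ) fun t ht => ?_
  have hexp : MemLp (fun x : ℝ => Real.exp (t * x)) 2 ν := by
    rw [memLp_two_iff_integrable_sq (by fun_prop)]
    refine (h (2 * t) ⟨by linarith [ht.1], by linarith [ht.2]⟩).congr (ae_of_all _ fun x => ?_)
    simp only [id, ← Real.exp_nat_mul]
    congr 1; push_cast; ring
  have hf' : MemLp (fun x => max (f x) 0) 2 ν := hf.pos_part
  rw [integrable_withDensity_iff_integrable_smul₀']
  · refine (hf'.integrable_mul hexp).congr (ae_of_all _ fun x => ?_)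
    simp [ENNReal.toReal_ofReal']
  · exact hf.1.aemeasurable.ennreal_ofReal
  · simp

lemma integral_pow_withDensity_ofReal {ν : Measure ℝ} {f : ℝ → ℝ} (hf : MemLp f 2 ν) (n : ℕ) :
    ∫ x, x ^ n ∂(ν.withDensity fun x => ENNReal.ofReal (f x)) = ∫ x, max (f x) 0 * x ^ n ∂ν := by
  rw [integral_withDensity_eq_integral_toReal_smul₀ hf.1.aemeasurable.ennreal_ofReal (by simp)]
  simp [ENNReal.toReal_ofReal']

lemma memLp_pow_of_zero_mem_interior {ν : Measure ℝ}
    (hν : 0 ∈ interior (integrableExpSet id ν)) (n : ℕ) : MemLp (fun x : ℝ => x ^ n) 2 ν := by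
  rw [memLp_two_iff_integrable_sq (by fun_prop)]
  simpa [pow_mul] using integrable_pow_of_mem_interior_integrableExpSet hν (n * 2)

/-- A square-integrable function orthogonal to all monomials vanishes, if the underlying measure has
a moment-generating function near `0`. -/
lemma ae_eq_zero_of_forall_integral_mul_pow_eq_zero {ν : Measure ℝ} [IsFiniteMeasure ν]
    (hν : 0 ∈ interior (integrableExpSet id ν)) {f : ℝ → ℝ} (hf : MemLp f 2 ν)
    (h : ∀ n : ℕ, ∫ x, f x * x ^ n ∂ν = 0) : f =ᵐ[ν] 0 := by
  have hfi : Integrable f ν := hf.integrable one_le_two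
  have hneg : MemLp (fun x => -f x) 2 ν := hf.neg
  have := isFiniteMeasure_withDensity_ofReal hfi.2
  have := isFiniteMeasure_withDensity_ofReal (f := fun x => -f x) hfi.neg.2
  have key := Measure.ext_of_forall_integral_pow_eq
    (zero_mem_interior_integrableExpSet_withDensity hν hf)
    (zero_mem_interior_integrableExpSet_withDensity hν hneg) fun n => by
      have hp := memLp_pow_of_zero_mem_interior hν n
      have h1 : Integrable (fun x => max (f x) 0 * x ^ n) ν := hf.pos_part.integrable_mul hp
      have h2 : Integrable (fun x => max (-f x) 0 * x ^ n) ν := hneg.pos_part.integrable_mul hp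
      rw [integral_pow_withDensity_ofReal hf, integral_pow_withDensity_ofReal hneg, ← sub_eq_zero,
        ← integral_sub h1 h2]
      refine (integral_congr_ae (ae_of_all _ fun x => ?_)).trans (h n)
      rcases le_total 0 (f x) with h0 | h0 <;> simp [h0]
  rw [withDensity_eq_iff_of_sigmaFinite hf.1.aemeasurable.ennreal_ofReal
    hneg.1.aemeasurable.ennreal_ofReal] at key
  filter_upwards [key] with x hx
  have := congrArg ENNReal.toReal hx
  simp only [ENNReal.toReal_ofReal'] at this
  rcases le_total 0 (f x) with h0 | h0 <;> simp [h0] at this ⊢ <;> simpa using this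

lemma memLp_polynomial_eval {ν : Measure ℝ}
    (hν : 0 ∈ interior (integrableExpSet id ν)) (p : Polynomial ℝ) :
    MemLp (fun x => p.eval x) 2 ν := by
  simp only [Polynomial.eval_eq_sum_range]
  exact memLp_finsetSum _ fun i _ => (memLp_pow_of_zero_mem_interior hν i).const_mul _

/-- Polynomials are dense in `L²(ν)` when `ν` has a moment-generating function near `0`. -/
lemma exists_polynomial_eLpNorm_sub_lt {ν : Measure ℝ} [IsFiniteMeasure ν]
    (hν : 0 ∈ interior (integrableExpSet id ν)) {f : ℝ → ℝ} (hf : MemLp f 2 ν) {ε : ℝ≥0∞}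
    (hε : ε ≠ 0) : ∃ p : Polynomial ℝ, eLpNorm (fun x => f x - p.eval x) 2 ν < ε := by
  let L : Polynomial ℝ →ₗ[ℝ] Lp ℝ 2 ν :=
    { toFun := fun p => (memLp_polynomial_eval hν p).toLp _
      map_add' := fun p q => by
        rw [← MemLp.toLp_add]; congr 1; ext x; simp
      map_smul' := fun c p => by
        rw [RingHom.id_apply, ← MemLp.toLp_const_smul]; congr 1; ext x; simp }
  have htop : L.range.topologicalClosure = ⊤ := by
    rw [Submodule.topologicalClosure_eq_top_iff, Submodule.eq_bot_iff]
    intro g hg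
    rw [Lp.eq_zero_iff_ae_eq_zero]
    refine ae_eq_zero_of_forall_integral_mul_pow_eq_zero hν (Lp.memLp g) fun n => ?_
    have := (Submodule.mem_orthogonal _ _).1 hg (L (Polynomial.X ^ n)) ⟨_, rfl⟩
    rw [L2.inner_def] at this
    rw [← this]
    refine integral_congr_ae ?_
    filter_upwards [(memLp_polynomial_eval hν (Polynomial.X ^ n)).coeFn_toLp] with x hx
    change _ = inner ℝ ((MemLp.toLp _ (memLp_polynomial_eval hν (Polynomial.X ^ n)) : Lp ℝ 2 ν) x) _
    rw [hx]
    simp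
  have hmem : hf.toLp f ∈ closure (L.range : Set (Lp ℝ 2 ν)) := by
    rw [← Submodule.topologicalClosure_coe, htop]; trivial
  obtain ⟨_, ⟨p, rfl⟩, hp⟩ := EMetric.mem_closure_iff.1 hmem ε hε.bot_lt
  refine ⟨p, ?_⟩
  rwa [show L p = (memLp_polynomial_eval hν p).toLp _ from rfl, Lp.edist_toLp_toLp] at hp

/-- Integrals of functions of `(X, s X + N)` in terms of the Gaussian transition density. -/
lemma lintegral_comp_mul_add_gaussian {Ω : Type*} [MeasurableSpace Ω] {P : Measure Ω}
    [IsProbabilityMeasure P] {X N : Ω → ℝ} (hX : Measurable X) (hNm : Measurable N)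
    (hN : P.map N = gaussianReal 0 1) (hXN : IndepFun X N P) (s : ℝ)
    {F : ℝ × ℝ → ℝ≥0∞} (hF : Measurable F) :
    ∫⁻ ω, F (X ω, s * X ω + N ω) ∂P =
      ∫⁻ z, F z * ENNReal.ofReal (gaussianPDFReal 0 1 (z.2 - s * z.1))
        ∂((P.map X).prod volume) := by
  have : IsProbabilityMeasure (P.map X) := Measure.isProbabilityMeasure_map hX.aemeasurable
  have hw : Measurable (fun z : ℝ × ℝ => ENNReal.ofReal (gaussianPDFReal 0 1 (z.2 - s * z.1))) :=
    ((measurable_gaussianPDFReal 0 1).comp (by fun_prop)).ennreal_ofReal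
  have hmap := (indepFun_iff_map_prod_eq_prod_map_map hX.aemeasurable hNm.aemeasurable).1 hXN
  have hG : Measurable (fun z : ℝ × ℝ => F (z.1, s * z.1 + z.2)) := hF.comp (by fun_prop)
  calc ∫⁻ ω, F (X ω, s * X ω + N ω) ∂P
      = ∫⁻ z, F (z.1, s * z.1 + z.2) ∂(P.map fun ω => (X ω, N ω)) :=
        (lintegral_map hG (hX.prodMk hNm)).symm
    _ = ∫⁻ x, ∫⁻ u, F (x, s * x + u) ∂(gaussianReal 0 1) ∂(P.map X) := by
        rw [hmap, hN, lintegral_prod _ hG.aemeasurable]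
    _ = _ := by
        rw [lintegral_prod (fun z : ℝ × ℝ => F z * _) (hF.mul hw).aemeasurable]
        refine lintegral_congr fun x => ?_
        rw [gaussianReal_of_var_ne_zero _ one_ne_zero,
          lintegral_withDensity_eq_lintegral_mul _ (measurable_gaussianPDF 0 1)
            (show Measurable fun u => F (x, s * x + u) from hF.comp (by fun_prop)),
          ← lintegral_add_left_eq_self (μ := volume) (fun y => F (x, y) *
            ENNReal.ofReal (gaussianPDFReal 0 1 (y - s * x))) (s * x)]
        refine lintegral_congr fun u => ?_
        simp [gaussianPDF, mul_comm]

/-- The posterior mean of `X` given that `s X + N = y`, where `X` has law `μ` and `N` is an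
independent standard Gaussian. -/
noncomputable def posteriorMean (μ : Measure ℝ) (s y : ℝ) : ℝ :=
  (∫ x, x * gaussianPDFReal 0 1 (y - s * x) ∂μ) / ∫ x, gaussianPDFReal 0 1 (y - s * x) ∂μ

lemma continuous_gaussianPDFReal_std : Continuous (gaussianPDFReal 0 1) := by
  unfold gaussianPDFReal; fun_prop

lemma gaussianPDFReal_std_le_one (x : ℝ) : gaussianPDFReal 0 1 x ≤ 1 := by
  unfold gaussianPDFReal
  refine mul_le_one₀ (inv_le_one_of_one_le₀ ?_) (Real.exp_pos _).le (Real.exp_le_one_iff.2 ?_)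
  · rw [Real.one_le_sqrt]
    have := Real.pi_gt_three
    push_cast; linarith
  · have := sq_nonneg (x - 0)
    push_cast; simp only [neg_div]; linarith [div_nonneg this (by norm_num : (0:ℝ) ≤ 2 * 1)]

lemma abs_mul_gaussianPDFReal_std_le (a x : ℝ) : ‖a * gaussianPDFReal 0 1 x‖ ≤ ‖a‖ := by
  rw [norm_mul, Real.norm_of_nonneg (gaussianPDFReal_nonneg 0 1 x)]
  exact mul_le_of_le_one_right (norm_nonneg _) (gaussianPDFReal_std_le_one x)

lemma integrable_mul_gaussianPDFReal_std {μ : Measure ℝ} {f : ℝ → ℝ} (hf : Integrable f μ)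
    (s y : ℝ) : Integrable (fun x => f x * gaussianPDFReal 0 1 (y - s * x)) μ :=
  hf.mono (hf.1.mul (continuous_gaussianPDFReal_std.comp (by fun_prop)).aestronglyMeasurable)
    (ae_of_all _ fun _ => abs_mul_gaussianPDFReal_std_le _ _)

lemma continuous_integral_mul_gaussianPDFReal_std {μ : Measure ℝ} {f : ℝ → ℝ}
    (hf : Integrable f μ) :
    Continuous fun z : ℝ × ℝ => ∫ x, f x * gaussianPDFReal 0 1 (z.2 - z.1 * x) ∂μ :=
  continuous_of_dominated (fun z => (integrable_mul_gaussianPDFReal_std hf z.1 z.2).1)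
    (fun _ => ae_of_all _ fun _ => abs_mul_gaussianPDFReal_std_le _ _) hf.norm
    (ae_of_all _ fun _ => continuous_const.mul (continuous_gaussianPDFReal_std.comp (by fun_prop)))

lemma integral_gaussianPDFReal_std_pos (μ : Measure ℝ) [IsProbabilityMeasure μ] (s y : ℝ) :
    0 < ∫ x, gaussianPDFReal 0 1 (y - s * x) ∂μ := by
  have hi : Integrable (fun x => gaussianPDFReal 0 1 (y - s * x)) μ := by
    simpa using integrable_mul_gaussianPDFReal_std (integrable_const (1 : ℝ)) s y
  refine (integral_pos_iff_support_of_nonneg (fun _ => gaussianPDFReal_nonneg _ _ _) hi).2 ?_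
  have : Function.support (fun x => gaussianPDFReal 0 1 (y - s * x)) = Set.univ :=
    Set.eq_univ_of_forall fun x => (gaussianPDFReal_pos _ _ _ one_ne_zero).ne'
  simp [this]

lemma continuous_posteriorMean {μ : Measure ℝ} [IsProbabilityMeasure μ] (hμ : Integrable id μ) :
    Continuous fun z : ℝ × ℝ => posteriorMean μ z.1 z.2 :=
  (continuous_integral_mul_gaussianPDFReal_std hμ).div
    (by simpa using continuous_integral_mul_gaussianPDFReal_std (integrable_const (1 : ℝ)))
    fun _ => (integral_gaussianPDFReal_std_pos μ _ _).ne'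

lemma measurable_posteriorMean {μ : Measure ℝ} [IsProbabilityMeasure μ] (hμ : Integrable id μ)
    (s : ℝ) : Measurable (posteriorMean μ s) := by
  have h := (continuous_posteriorMean hμ).comp (Continuous.prodMk_right s)
  exact h.measurable

/-- The posterior mean minimizes the posterior mean-square error. -/
lemma lintegral_sq_sub_posteriorMean_le {μ : Measure ℝ} [IsProbabilityMeasure μ]
    (hμ : MemLp id 2 μ) (s y a : ℝ) :
    ∫⁻ x, ENNReal.ofReal ((x - posteriorMean μ s y) ^ 2) *
        ENNReal.ofReal (gaussianPDFReal 0 1 (y - s * x)) ∂μ ≤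
      ∫⁻ x, ENNReal.ofReal ((x - a) ^ 2) *
        ENNReal.ofReal (gaussianPDFReal 0 1 (y - s * x)) ∂μ := by
  have hi (c : ℝ) : Integrable (fun x => (x - c) ^ 2 * gaussianPDFReal 0 1 (y - s * x)) μ :=
    integrable_mul_gaussianPDFReal_std (hμ.sub (memLp_const c)).integrable_sq s y
  have hx : Integrable (fun x => x * gaussianPDFReal 0 1 (y - s * x)) μ :=
    integrable_mul_gaussianPDFReal_std (hμ.integrable one_le_two) s y
  have h1 : Integrable (fun x => gaussianPDFReal 0 1 (y - s * x)) μ := by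
    simpa using integrable_mul_gaussianPDFReal_std (integrable_const (1 : ℝ)) s y
  simp_rw [← ENNReal.ofReal_mul (sq_nonneg _)]
  rw [← ofReal_integral_eq_lintegral_ofReal (hi _)
      (ae_of_all _ fun x => mul_nonneg (sq_nonneg _) (gaussianPDFReal_nonneg _ _ _)),
    ← ofReal_integral_eq_lintegral_ofReal (hi _)
      (ae_of_all _ fun x => mul_nonneg (sq_nonneg _) (gaussianPDFReal_nonneg _ _ _))]
  refine ENNReal.ofReal_le_ofReal (sub_nonneg.1 ?_)
  have hpos := integral_gaussianPDFReal_std_pos μ s y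
  have hmean : ∫ x, x * gaussianPDFReal 0 1 (y - s * x) ∂μ =
      posteriorMean μ s y * ∫ x, gaussianPDFReal 0 1 (y - s * x) ∂μ := by
    rw [posteriorMean, div_mul_cancel₀ _ hpos.ne']
  set h := posteriorMean μ s y
  calc (0 : ℝ) ≤ (h - a) ^ 2 * ∫ x, gaussianPDFReal 0 1 (y - s * x) ∂μ := by positivity
    _ = 2 * (h - a) * ∫ x, x * gaussianPDFReal 0 1 (y - s * x) ∂μ
        - (h ^ 2 - a ^ 2) * ∫ x, gaussianPDFReal 0 1 (y - s * x) ∂μ := by rw [hmean]; ring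
    _ = _ := by
      rw [← integral_sub (hi a) (hi h), ← integral_const_mul, ← integral_const_mul,
        ← integral_sub (hx.const_mul _) (h1.const_mul _)]
      exact integral_congr_ae (ae_of_all _ fun x => by ring)

/-- The Bayes risk of the posterior mean, as an integral against the transition density. -/
noncomputable def gaussianBayesRisk (μ : Measure ℝ) (s : ℝ) : ℝ≥0∞ :=
  ∫⁻ z, ENNReal.ofReal ((z.1 - posteriorMean μ s z.2) ^ 2) *
    ENNReal.ofReal (gaussianPDFReal 0 1 (z.2 - s * z.1)) ∂(μ.prod volume)

lemma lowerSemicontinuous_gaussianBayesRisk {μ : Measure ℝ} [IsProbabilityMeasure μ]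
    (hμ : Integrable id μ) : LowerSemicontinuous (gaussianBayesRisk μ) := by
  intro s₀
  have hc : Continuous fun q : ℝ × (ℝ × ℝ) =>
      ENNReal.ofReal ((q.2.1 - posteriorMean μ q.1 q.2.2) ^ 2) *
        ENNReal.ofReal (gaussianPDFReal 0 1 (q.2.2 - q.1 * q.2.1)) := by
    simp_rw [← ENNReal.ofReal_mul (sq_nonneg _)]
    have h : Continuous fun q : ℝ × (ℝ × ℝ) => (q.1, q.2.2) := by fun_prop
    have h1 := (continuous_posteriorMean hμ).comp h
    have h2 : Continuous fun q : ℝ × (ℝ × ℝ) => gaussianPDFReal 0 1 (q.2.2 - q.1 * q.2.1) :=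
      continuous_gaussianPDFReal_std.comp (by fun_prop)
    exact ENNReal.continuous_ofReal.comp
      (((continuous_fst.comp continuous_snd).sub h1).pow 2 |>.mul h2)
  refine lowerSemicontinuousAt_iff_le_liminf.2 ?_
  refine le_trans (lintegral_mono fun z => ?_) (lintegral_liminf_le fun s =>
    (hc.comp (Continuous.prodMk_right s)).measurable)
  exact (hc.comp (Continuous.prodMk_left z)).continuousAt.tendsto.liminf_eq.ge

lemma bddBelow_range_integral_sq {Ω : Type*} [MeasurableSpace Ω] (P : Measure Ω)
    (X Y : Ω → ℝ) (n : ℕ) : BddBelow (Set.range fun c : Fin (n + 1) → ℝ =>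
      ∫ ω, (X ω - ∑ j : Fin (n + 1), c j * Y ω ^ (j : ℕ)) ^ 2 ∂P) :=
  ⟨0, by rintro _ ⟨c, rfl⟩; exact integral_nonneg fun _ => sq_nonneg _⟩

lemma pmmse_le_integral_sq_sub_eval {Ω : Type*} [MeasurableSpace Ω] (P : Measure Ω)
    (X Y : Ω → ℝ) {n : ℕ} {p : Polynomial ℝ} (hp : p.natDegree ≤ n) :
    pmmse P X Y n ≤ ∫ ω, (X ω - p.eval (Y ω)) ^ 2 ∂P := by
  refine (ciInf_le (bddBelow_range_integral_sq P X Y n) fun j => p.coeff j).trans_eq ?_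
  simp only [Polynomial.eval_eq_sum_range' (Nat.lt_succ_of_le hp), Finset.sum_range]

lemma zero_mem_interior_integrableExpSet_map {Ω : Type*} [MeasurableSpace Ω]
    {μ : Measure Ω} {Y : Ω → ℝ} (hY : AEMeasurable Y μ) (h : 0 ∈ interior (integrableExpSet Y μ)) :
    0 ∈ interior (integrableExpSet id (μ.map Y)) := by
  convert h using 2
  ext t
  exact integrable_map_measure (g := fun x => Real.exp (t * id x)) (by fun_prop) hY

lemma zero_mem_interior_integrableExpSet_gaussian {Ω : Type*} [MeasurableSpace Ω]
    {P : Measure Ω} {N : Ω → ℝ} (hNm : Measurable N) (hN : P.map N = gaussianReal 0 1) :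
    0 ∈ interior (integrableExpSet N P) := by
  refine zero_mem_interior_integrableExpSet one_pos fun t _ => ?_
  have h := integrable_exp_mul_gaussianReal (μ := 0) (v := 1) t
  rw [← hN] at h
  exact h.comp_measurable hNm

lemma zero_mem_interior_integrableExpSet_mul_add {Ω : Type*} [MeasurableSpace Ω]
    {P : Measure Ω} {X N : Ω → ℝ} (hX0 : 0 ∈ interior (integrableExpSet X P))
    (hN0 : 0 ∈ interior (integrableExpSet N P)) (hXN : IndepFun X N P) (s : ℝ) :
    0 ∈ interior (integrableExpSet (fun ω => s * X ω + N ω) P) := by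
  obtain ⟨δ, hδ, h1⟩ := exists_of_zero_mem_interior_integrableExpSet hX0
  obtain ⟨η, hη, h2⟩ := exists_of_zero_mem_interior_integrableExpSet hN0
  have hpos : 0 < |s| + 1 := by positivity
  refine zero_mem_interior_integrableExpSet (lt_min (div_pos hδ hpos) hη) fun t ht => ?_
  have ht' := abs_lt.2 ht
  have hts : |t * s| < δ := by
    have h3 := (lt_div_iff₀ hpos).1 (ht'.trans_le (min_le_left _ _))
    rw [abs_mul]; nlinarith [abs_nonneg t, abs_nonneg s]
  have hind : IndepFun (fun ω => s * X ω) N P :=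
    hXN.comp (φ := fun x => s * x) (ψ := id) (by fun_prop) measurable_id
  refine hind.integrable_exp_mul_add ?_ (h2 t (abs_lt.1 (ht'.trans_le (min_le_right _ _))))
  simpa [mul_assoc] using h1 (t * s) (abs_lt.1 hts)

lemma pmmse_sub_mmse_le_div {Ω : Type*} [MeasurableSpace Ω]
    {P : Measure Ω} {X N : Ω → ℝ} {s : ℝ} (hs : s ≠ 0) {n : ℕ} (hn : 1 ≤ n) :
    pmmse P X (fun ω => s * X ω + N ω) n - mmse P X (fun ω => s * X ω + N ω) ≤
      (∫ ω, N ω ^ 2 ∂P) / s ^ 2 := by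
  have h1 : 0 ≤ mmse P X (fun ω => s * X ω + N ω) := integral_nonneg fun _ => sq_nonneg _
  have h2 := pmmse_le_integral_sq_sub_eval P X (fun ω => s * X ω + N ω)
    ((Polynomial.natDegree_C_mul_X _ (inv_ne_zero hs)).trans_le hn)
  have h3 : ∫ ω, (X ω - (Polynomial.C s⁻¹ * Polynomial.X).eval (s * X ω + N ω)) ^ 2 ∂P =
      (∫ ω, N ω ^ 2 ∂P) / s ^ 2 := by
    rw [← integral_div]
    refine integral_congr_ae (ae_of_all _ fun ω => ?_)
    simp only [Polynomial.eval_mul, Polynomial.eval_C, Polynomial.eval_X]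
    field_simp
    ring
  linarith

/-- The conditional expectation is a best mean-square approximation. -/
lemma integral_sq_sub_condExp_le {Ω : Type*} {m m₀ : MeasurableSpace Ω} (hm : m ≤ m₀)
    {P : Measure Ω} [IsFiniteMeasure P] {X Z : Ω → ℝ} (hX : MemLp X 2 P) (hZ : MemLp Z 2 P)
    (hZm : StronglyMeasurable[m] Z) :
    ∫ ω, (X ω - (P[X | m]) ω) ^ 2 ∂P ≤ ∫ ω, (X ω - Z ω) ^ 2 ∂P := by
  have hE : MemLp (P[X | m]) 2 P := hX.condExp one_le_two
  have hres : MemLp (X - P[X | m]) 2 P := hX.sub hE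
  have hdif : MemLp (P[X | m] - Z) 2 P := hE.sub hZ
  have hint : Integrable ((X - P[X | m]) * (P[X | m] - Z)) P := hres.integrable_mul hdif
  have hz : ∫ ω, ((X - P[X | m]) * (P[X | m] - Z)) ω ∂P = 0 := by
    have h0 : P[X - P[X | m] | m] =ᵐ[P] 0 := by
      refine (condExp_sub (hX.integrable one_le_two) integrable_condExp m).trans ?_
      rw [condExp_of_stronglyMeasurable hm stronglyMeasurable_condExp integrable_condExp, sub_self]
    rw [← integral_condExp hm]
    refine integral_eq_zero_of_ae ?_
    filter_upwards [condExp_mul_of_stronglyMeasurable_right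
      (stronglyMeasurable_condExp.sub hZm) hint (hres.integrable one_le_two), h0] with ω h1 h2
    simp [h1, h2]
  have h2 := integral_add hres.integrable_sq ((hint.const_mul 2).add hdif.integrable_sq)
  have h3 := integral_add (hint.const_mul 2) hdif.integrable_sq
  rw [integral_const_mul, hz] at h3
  have h4 : 0 ≤ ∫ ω, (P[X | m] - Z) ω ^ 2 ∂P := integral_nonneg fun _ => sq_nonneg _
  have h5 : ∫ ω, (X ω - Z ω) ^ 2 ∂P = ∫ ω, ((X - P[X | m]) ω ^ 2 +
      ((fun ω => 2 * ((X - P[X | m]) * (P[X | m] - Z)) ω) + fun ω => (P[X | m] - Z) ω ^ 2) ω) ∂P :=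
    integral_congr_ae (ae_of_all _ fun ω => by simp; ring)
  have h6 : ∫ ω, ((fun ω => 2 * ((X - P[X | m]) * (P[X | m] - Z)) ω) +
      fun ω => (P[X | m] - Z) ω ^ 2) ω ∂P = 2 * 0 + ∫ ω, (P[X | m] - Z) ω ^ 2 ∂P := h3
  rw [h5, h2, h6]
  simp only [Pi.sub_apply] at h4 ⊢
  linarith

section Channel

variable {Ω : Type*} [MeasurableSpace Ω] {P : Measure Ω} [IsProbabilityMeasure P] {X N : Ω → ℝ}

lemma lintegral_sq_sub_posteriorMean (hX : Measurable X) (hNm : Measurable N)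
    (hX2 : MemLp X 2 P) (hN : P.map N = gaussianReal 0 1) (hXN : IndepFun X N P) (s : ℝ) :
    ∫⁻ ω, ENNReal.ofReal ((X ω - posteriorMean (P.map X) s (s * X ω + N ω)) ^ 2) ∂P =
      gaussianBayesRisk (P.map X) s := by
  have : IsProbabilityMeasure (P.map X) := Measure.isProbabilityMeasure_map hX.aemeasurable
  have hμ : MemLp id 2 (P.map X) :=
    (memLp_map_measure_iff aestronglyMeasurable_id hX.aemeasurable).2 hX2
  have hc : Measurable (posteriorMean (P.map X) s) :=
    measurable_posteriorMean (hμ.integrable one_le_two) s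
  have hF : Measurable fun z : ℝ × ℝ =>
      ENNReal.ofReal ((z.1 - posteriorMean (P.map X) s z.2) ^ 2) :=
    ((measurable_fst.sub (hc.comp measurable_snd)).pow_const 2).ennreal_ofReal
  exact lintegral_comp_mul_add_gaussian hX hNm hN hXN s hF

lemma gaussianBayesRisk_le_lintegral (hX : Measurable X) (hNm : Measurable N)
    (hX2 : MemLp X 2 P) (hN : P.map N = gaussianReal 0 1) (hXN : IndepFun X N P) (s : ℝ)
    {g : ℝ → ℝ} (hg : Measurable g) :
    gaussianBayesRisk (P.map X) s ≤ ∫⁻ ω, ENNReal.ofReal ((X ω - g (s * X ω + N ω)) ^ 2) ∂P := by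
  have : IsProbabilityMeasure (P.map X) := Measure.isProbabilityMeasure_map hX.aemeasurable
  have hμ : MemLp id 2 (P.map X) :=
    (memLp_map_measure_iff aestronglyMeasurable_id hX.aemeasurable).2 hX2
  have hc : Measurable (posteriorMean (P.map X) s) :=
    measurable_posteriorMean (hμ.integrable one_le_two) s
  have hw : Measurable (fun z : ℝ × ℝ => ENNReal.ofReal (gaussianPDFReal 0 1 (z.2 - s * z.1))) :=
    ((measurable_gaussianPDFReal 0 1).comp (by fun_prop)).ennreal_ofReal
  have hF {k : ℝ → ℝ} (hk : Measurable k) : Measurable fun z : ℝ × ℝ =>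
      ENNReal.ofReal ((z.1 - k z.2) ^ 2) :=
    ((measurable_fst.sub (hk.comp measurable_snd)).pow_const 2).ennreal_ofReal
  refine le_of_le_of_eq ?_ (lintegral_comp_mul_add_gaussian hX hNm hN hXN s (hF hg)).symm
  rw [gaussianBayesRisk, lintegral_prod_symm (fun z : ℝ × ℝ =>
      ENNReal.ofReal ((z.1 - posteriorMean (P.map X) s z.2) ^ 2) * _)
      ((hF hc).mul hw).aemeasurable,
    lintegral_prod_symm (fun z : ℝ × ℝ => ENNReal.ofReal ((z.1 - g z.2) ^ 2) * _)
      ((hF hg).mul hw).aemeasurable]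
  exact lintegral_mono fun y => lintegral_sq_sub_posteriorMean_le hμ s y (g y)

lemma gaussianBayesRisk_le_integral (hX : Measurable X) (hNm : Measurable N)
    (hX2 : MemLp X 2 P) (hN : P.map N = gaussianReal 0 1) (hXN : IndepFun X N P) (s : ℝ)
    {g : ℝ → ℝ} (hg : Measurable g) (hg2 : MemLp (fun ω => g (s * X ω + N ω)) 2 P) :
    gaussianBayesRisk (P.map X) s ≤ ENNReal.ofReal (∫ ω, (X ω - g (s * X ω + N ω)) ^ 2 ∂P) := by
  have hd : MemLp (fun ω => X ω - g (s * X ω + N ω)) 2 P := hX2.sub hg2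
  rw [ofReal_integral_eq_lintegral_ofReal hd.integrable_sq (ae_of_all _ fun _ => sq_nonneg _)]
  exact gaussianBayesRisk_le_lintegral hX hNm hX2 hN hXN s hg

lemma gaussianBayesRisk_ne_top (hX : Measurable X) (hNm : Measurable N)
    (hX2 : MemLp X 2 P) (hN : P.map N = gaussianReal 0 1) (hXN : IndepFun X N P) (s : ℝ) :
    gaussianBayesRisk (P.map X) s ≠ ∞ :=
  ne_top_of_le_ne_top ENNReal.ofReal_ne_top (gaussianBayesRisk_le_integral hX hNm hX2 hN hXN s
    (measurable_const (a := (0 : ℝ))) (memLp_const 0))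

lemma memLp_posteriorMean (hX : Measurable X) (hNm : Measurable N)
    (hX2 : MemLp X 2 P) (hN : P.map N = gaussianReal 0 1) (hXN : IndepFun X N P) (s : ℝ) :
    MemLp (fun ω => posteriorMean (P.map X) s (s * X ω + N ω)) 2 P := by
  have : IsProbabilityMeasure (P.map X) := Measure.isProbabilityMeasure_map hX.aemeasurable
  have hμ : MemLp id 2 (P.map X) :=
    (memLp_map_measure_iff aestronglyMeasurable_id hX.aemeasurable).2 hX2
  have hc : Measurable (posteriorMean (P.map X) s) :=
    measurable_posteriorMean (hμ.integrable one_le_two) s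
  have hmeas : Measurable fun ω => X ω - posteriorMean (P.map X) s (s * X ω + N ω) :=
    hX.sub (hc.comp (by fun_prop))
  have hres : MemLp (fun ω => X ω - posteriorMean (P.map X) s (s * X ω + N ω)) 2 P := by
    refine (memLp_two_iff_integrable_sq hmeas.aestronglyMeasurable).2
      ((lintegral_ofReal_ne_top_iff_integrable (hmeas.pow_const 2).aestronglyMeasurable
        (ae_of_all _ fun _ => sq_nonneg _)).1 ?_)
    rw [lintegral_sq_sub_posteriorMean hX hNm hX2 hN hXN s]
    exact gaussianBayesRisk_ne_top hX hNm hX2 hN hXN s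
  refine (hX2.sub hres).ae_eq (ae_of_all _ fun ω => ?_)
  simp

lemma ofReal_integral_sq_sub_posteriorMean (hX : Measurable X) (hNm : Measurable N)
    (hX2 : MemLp X 2 P) (hN : P.map N = gaussianReal 0 1) (hXN : IndepFun X N P) (s : ℝ) :
    ENNReal.ofReal (∫ ω, (X ω - posteriorMean (P.map X) s (s * X ω + N ω)) ^ 2 ∂P) =
      gaussianBayesRisk (P.map X) s := by
  have hd : MemLp (fun ω => X ω - posteriorMean (P.map X) s (s * X ω + N ω)) 2 P :=
    hX2.sub (memLp_posteriorMean hX hNm hX2 hN hXN s)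
  rw [ofReal_integral_eq_lintegral_ofReal hd.integrable_sq (ae_of_all _ fun _ => sq_nonneg _)]
  exact lintegral_sq_sub_posteriorMean hX hNm hX2 hN hXN s

lemma mmse_mul_add_gaussian (hX : Measurable X) (hNm : Measurable N)
    (hX2 : MemLp X 2 P) (hN : P.map N = gaussianReal 0 1) (hXN : IndepFun X N P) (s : ℝ) :
    mmse P X (fun ω => s * X ω + N ω) = (gaussianBayesRisk (P.map X) s).toReal := by
  have : IsProbabilityMeasure (P.map X) := Measure.isProbabilityMeasure_map hX.aemeasurable
  have hμ : MemLp id 2 (P.map X) :=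
    (memLp_map_measure_iff aestronglyMeasurable_id hX.aemeasurable).2 hX2
  have hc : Measurable (posteriorMean (P.map X) s) :=
    measurable_posteriorMean (hμ.integrable one_le_two) s
  have hY : Measurable fun ω => s * X ω + N ω := by fun_prop
  have hnn : 0 ≤ mmse P X (fun ω => s * X ω + N ω) := integral_nonneg fun _ => sq_nonneg _
  refine le_antisymm ?_ ?_
  · rw [← ofReal_integral_sq_sub_posteriorMean hX hNm hX2 hN hXN s,
      ENNReal.toReal_ofReal (integral_nonneg fun _ => sq_nonneg _)]
    exact integral_sq_sub_condExp_le hY.comap_le hX2 (memLp_posteriorMean hX hNm hX2 hN hXN s)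
      (hc.comp (comap_measurable _)).stronglyMeasurable
  · obtain ⟨k, hk, hkeq⟩ := (stronglyMeasurable_condExp (μ := P) (f := X)
      (m := MeasurableSpace.comap (fun ω => s * X ω + N ω)
        Real.measurableSpace)).measurable.exists_eq_measurable_comp
    have hk2 : MemLp (fun ω => k (s * X ω + N ω)) 2 P := by
      have := hX2.condExp (m := MeasurableSpace.comap (fun ω => s * X ω + N ω)
        Real.measurableSpace) one_le_two
      rwa [hkeq] at this
    refine ENNReal.toReal_le_of_le_ofReal hnn ?_
    rw [mmse, hkeq]
    exact gaussianBayesRisk_le_integral hX hNm hX2 hN hXN s hk hk2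

lemma lowerSemicontinuous_mmse_mul_add_gaussian (hX : Measurable X) (hNm : Measurable N)
    (hX2 : MemLp X 2 P) (hN : P.map N = gaussianReal 0 1) (hXN : IndepFun X N P) :
    LowerSemicontinuous fun s => mmse P X (fun ω => s * X ω + N ω) := by
  have : IsProbabilityMeasure (P.map X) := Measure.isProbabilityMeasure_map hX.aemeasurable
  have hμ : MemLp id 2 (P.map X) :=
    (memLp_map_measure_iff aestronglyMeasurable_id hX.aemeasurable).2 hX2
  intro s a ha
  simp only [mmse_mul_add_gaussian hX hNm hX2 hN hXN] at ha ⊢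
  rcases lt_or_ge a 0 with h0 | h0
  · exact .of_forall fun _ => h0.trans_le ENNReal.toReal_nonneg
  · have := lowerSemicontinuous_gaussianBayesRisk (hμ.integrable one_le_two) s (ENNReal.ofReal a)
      ((ENNReal.ofReal_lt_iff_lt_toReal h0 (gaussianBayesRisk_ne_top hX hNm hX2 hN hXN s)).2 ha)
    filter_upwards [this] with r hr
    exact (ENNReal.ofReal_lt_iff_lt_toReal h0 (gaussianBayesRisk_ne_top hX hNm hX2 hN hXN r)).1 hr

/-- Polynomial estimators come arbitrarily close to the minimum mean-square error. -/
lemma exists_polynomial_integral_sq_lt (hX : Measurable X) (hNm : Measurable N)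
    (hX0 : 0 ∈ interior (integrableExpSet X P)) (hN : P.map N = gaussianReal 0 1)
    (hXN : IndepFun X N P) (s : ℝ) {ε : ℝ} (hε : 0 < ε) :
    ∃ p : Polynomial ℝ, ∫ ω, (X ω - p.eval (s * X ω + N ω)) ^ 2 ∂P <
      mmse P X (fun ω => s * X ω + N ω) + ε := by
  have : IsProbabilityMeasure (P.map X) := Measure.isProbabilityMeasure_map hX.aemeasurable
  have hX2 : MemLp X 2 P := memLp_of_mem_interior_integrableExpSet hX0 2
  have hμ : MemLp id 2 (P.map X) :=
    (memLp_map_measure_iff aestronglyMeasurable_id hX.aemeasurable).2 hX2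
  have hc : Measurable (posteriorMean (P.map X) s) :=
    measurable_posteriorMean (hμ.integrable one_le_two) s
  have hY : Measurable fun ω => s * X ω + N ω := by fun_prop
  have hY0 := zero_mem_interior_integrableExpSet_map hY.aemeasurable
    (zero_mem_interior_integrableExpSet_mul_add hX0
      (zero_mem_interior_integrableExpSet_gaussian hNm hN) hXN s)
  have hh2 := memLp_posteriorMean hX hNm hX2 hN hXN s
  have hd : MemLp (fun ω => X ω - posteriorMean (P.map X) s (s * X ω + N ω)) 2 P := hX2.sub hh2
  have hν : IsProbabilityMeasure (P.map fun ω => s * X ω + N ω) :=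
    Measure.isProbabilityMeasure_map hY.aemeasurable
  have hmm : mmse P X (fun ω => s * X ω + N ω) =
      ∫ ω, (X ω - posteriorMean (P.map X) s (s * X ω + N ω)) ^ 2 ∂P := by
    rw [mmse_mul_add_gaussian hX hNm hX2 hN hXN, ← ofReal_integral_sq_sub_posteriorMean hX hNm hX2
      hN hXN s, ENNReal.toReal_ofReal (integral_nonneg fun _ => sq_nonneg _)]
  set M := mmse P X (fun ω => s * X ω + N ω)
  have hM : 0 ≤ M := integral_nonneg fun _ => sq_nonneg _
  set η := ε / (2 * (M + 1)) with hη
  have hηpos : 0 < η := by positivity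
  have hηM : η * M < ε / 2 := by
    rw [hη, div_mul_eq_mul_div, div_lt_div_iff₀ (by positivity) two_pos]; nlinarith
  set κ := ε / (2 * (1 + η⁻¹)) with hκ
  have hκpos : 0 < κ := by positivity
  have hκη : (1 + η⁻¹) * κ = ε / 2 := by rw [hκ]; field_simp
  obtain ⟨p, hp⟩ := exists_polynomial_eLpNorm_sub_lt hY0
    ((memLp_map_measure_iff hc.aestronglyMeasurable hY.aemeasurable).2 hh2)
    (ε := ENNReal.ofReal √κ) (by simpa using hκpos)
  have hpm : MemLp (fun ω => p.eval (s * X ω + N ω)) 2 P :=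
    (memLp_map_measure_iff p.continuous.aestronglyMeasurable hY.aemeasurable).1
      (memLp_polynomial_eval hY0 p)
  have he : MemLp (fun ω => posteriorMean (P.map X) s (s * X ω + N ω) -
      p.eval (s * X ω + N ω)) 2 P := hh2.sub hpm
  rw [eLpNorm_map_measure (show Measurable fun x => posteriorMean (P.map X) s x - p.eval x from
    hc.sub p.continuous.measurable).aestronglyMeasurable hY.aemeasurable] at hp
  have hb : ∫ ω, (posteriorMean (P.map X) s (s * X ω + N ω) -
      p.eval (s * X ω + N ω)) ^ 2 ∂P < κ := by
    change eLpNorm (fun ω => posteriorMean (P.map X) s (s * X ω + N ω) -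
      p.eval (s * X ω + N ω)) 2 P < _ at hp
    rw [he.eLpNorm_eq_integral_rpow_norm two_ne_zero ENNReal.ofNat_ne_top,
      ENNReal.ofReal_lt_ofReal_iff (Real.sqrt_pos.2 hκpos)] at hp
    refine (Real.sqrt_lt_sqrt_iff (integral_nonneg fun _ => sq_nonneg _)).1 ?_
    simpa [← Real.sqrt_eq_rpow, ← one_div] using hp
  refine ⟨p, ?_⟩
  calc ∫ ω, (X ω - p.eval (s * X ω + N ω)) ^ 2 ∂P
      ≤ ∫ ω, ((1 + η) * (X ω - posteriorMean (P.map X) s (s * X ω + N ω)) ^ 2 +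
          (1 + η⁻¹) * (posteriorMean (P.map X) s (s * X ω + N ω) -
            p.eval (s * X ω + N ω)) ^ 2) ∂P := by
        refine integral_mono (hX2.sub hpm).integrable_sq
          ((hd.integrable_sq.const_mul _).add (he.integrable_sq.const_mul _)) fun ω => ?_
        simp only
        generalize posteriorMean (P.map X) s (s * X ω + N ω) = h
        generalize p.eval (s * X ω + N ω) = q
        have h1 : 0 ≤ (η * (X ω - h) - (h - q)) ^ 2 / η := by positivity
        have h2 : (η * (X ω - h) - (h - q)) ^ 2 / η =
          η * (X ω - h) ^ 2 - 2 * (X ω - h) * (h - q) + η⁻¹ * (h - q) ^ 2 := by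
          field_simp; ring
        nlinarith
    _ = (1 + η) * M + (1 + η⁻¹) * ∫ ω, (posteriorMean (P.map X) s (s * X ω + N ω) -
            p.eval (s * X ω + N ω)) ^ 2 ∂P := by
        rw [integral_add (hd.integrable_sq.const_mul _) (he.integrable_sq.const_mul _),
          integral_const_mul, integral_const_mul, hmm]
    _ < M + ε := by
        have h3 := mul_lt_mul_of_pos_left hb (by positivity : 0 < 1 + η⁻¹)
        nlinarith

lemma memLp_pow_two {Z : Ω → ℝ} (hZ : ∀ p : ℝ≥0, MemLp Z p P) (n : ℕ) :
    MemLp (fun ω => Z ω ^ n) 2 P := by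
  refine (memLp_two_iff_integrable_sq ((hZ 1).1.pow n)).2 ?_
  have := (hZ (n * 2 : ℕ)).integrable_norm_pow'
  refine this.mono' (((hZ 1).1.pow n).pow 2) (ae_of_all _ fun ω => ?_)
  simp [← pow_mul]

lemma continuous_integral_sq_sub_eval (hX0 : 0 ∈ interior (integrableExpSet X P))
    (hN0 : 0 ∈ interior (integrableExpSet N P)) (p : Polynomial ℝ) :
    Continuous fun s : ℝ => ∫ ω, (X ω - p.eval (s * X ω + N ω)) ^ 2 ∂P := by
  have hX := memLp_of_mem_interior_integrableExpSet hX0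
  have hN := memLp_of_mem_interior_integrableExpSet hN0
  refine continuous_iff_continuousAt.2 fun s₀ => ?_
  set Z : Ω → ℝ := fun ω => (|s₀| + 1) * |X ω| + |N ω|
  have hZ (q : ℝ≥0) : MemLp Z q P := ((hX q).norm.const_mul _).add (hN q).norm
  set B : Ω → ℝ := fun ω => |X ω| + ∑ i ∈ Finset.range (p.natDegree + 1), |p.coeff i| * Z ω ^ i
  have hB : MemLp B 2 P := (hX 2).norm.add
    (memLp_finsetSum _ fun i _ => (memLp_pow_two hZ i).const_mul _)
  have hmeas (s : ℝ) : AEStronglyMeasurable (fun ω => (X ω - p.eval (s * X ω + N ω)) ^ 2) P :=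
    ((hX 1).1.sub (p.continuous.comp_aestronglyMeasurable
      (((hX 1).1.const_mul s).add (hN 1).1))).pow 2
  refine continuousAt_of_dominated (.of_forall hmeas) (bound := fun ω => B ω ^ 2) ?_
    hB.integrable_sq (ae_of_all _ fun ω => ?_)
  · filter_upwards [Metric.ball_mem_nhds s₀ one_pos] with s hs
    refine ae_of_all _ fun ω => ?_
    have hs' : |s| ≤ |s₀| + 1 := by
      rw [Metric.mem_ball, Real.dist_eq] at hs
      linarith [abs_sub_abs_le_abs_sub s s₀]
    have hYZ : |s * X ω + N ω| ≤ Z ω := by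
      refine (abs_add_le _ _).trans ?_
      rw [abs_mul]
      change _ ≤ (|s₀| + 1) * |X ω| + |N ω|
      gcongr
    rw [Real.norm_of_nonneg (sq_nonneg _), ← sq_abs]
    gcongr
    refine (abs_sub _ _).trans (add_le_add_right ?_ _)
    rw [Polynomial.eval_eq_sum_range]
    refine (Finset.abs_sum_le_sum_abs _ _).trans (Finset.sum_le_sum fun i _ => ?_)
    rw [abs_mul, abs_pow]
    gcongr
  · have := p.continuous
    fun_prop

lemma mmse_le_pmmse (hX : Measurable X) (hNm : Measurable N)
    (hX0 : 0 ∈ interior (integrableExpSet X P)) (hN : P.map N = gaussianReal 0 1)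
    (hXN : IndepFun X N P) (s : ℝ) (n : ℕ) :
    mmse P X (fun ω => s * X ω + N ω) ≤ pmmse P X (fun ω => s * X ω + N ω) n := by
  have hX2 : MemLp X 2 P := memLp_of_mem_interior_integrableExpSet hX0 2
  have hY := memLp_of_mem_interior_integrableExpSet (zero_mem_interior_integrableExpSet_mul_add hX0
    (zero_mem_interior_integrableExpSet_gaussian hNm hN) hXN s)
  refine le_ciInf fun c => ?_
  rw [mmse_mul_add_gaussian hX hNm hX2 hN hXN]
  refine ENNReal.toReal_le_of_le_ofReal (integral_nonneg fun _ => sq_nonneg _) ?_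
  exact gaussianBayesRisk_le_integral hX hNm hX2 hN hXN s
    (g := fun y => ∑ j : Fin (n + 1), c j * y ^ (j : ℕ)) (by fun_prop)
    (memLp_finsetSum _ fun i _ => (memLp_pow_two hY i).const_mul _)

/-- Near each `s₀`, the gap between polynomial and unrestricted estimation is eventually small,
uniformly. -/
lemma eventually_pmmse_sub_mmse_le (hX : Measurable X) (hNm : Measurable N)
    (hX0 : 0 ∈ interior (integrableExpSet X P)) (hN : P.map N = gaussianReal 0 1)
    (hXN : IndepFun X N P) (s₀ : ℝ) {ε : ℝ} (hε : 0 < ε) :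
    ∃ n₀ : ℕ, ∀ᶠ s in 𝓝 s₀, ∀ n ≥ n₀,
      pmmse P X (fun ω => s * X ω + N ω) n - mmse P X (fun ω => s * X ω + N ω) ≤ ε := by
  have hX2 : MemLp X 2 P := memLp_of_mem_interior_integrableExpSet hX0 2
  obtain ⟨p, hp⟩ := exists_polynomial_integral_sq_lt hX hNm hX0 hN hXN s₀ (half_pos hε)
  refine ⟨p.natDegree, ?_⟩
  have hcont := continuous_integral_sq_sub_eval hX0
    (zero_mem_interior_integrableExpSet_gaussian hNm hN) p
  filter_upwards [hcont.continuousAt.eventually_lt continuousAt_const hp,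
    lowerSemicontinuous_mmse_mul_add_gaussian hX hNm hX2 hN hXN s₀
      (mmse P X (fun ω => s₀ * X ω + N ω) - ε / 2) (by simpa using half_pos hε)] with s h1 h2 n hn
  have h3 := pmmse_le_integral_sq_sub_eval P X (fun ω => s * X ω + N ω) hn
  linarith

lemma exists_forall_pmmse_sub_mmse_le (hX : Measurable X) (hNm : Measurable N)
    (hX0 : 0 ∈ interior (integrableExpSet X P)) (hN : P.map N = gaussianReal 0 1)
    (hXN : IndepFun X N P) {K : Set ℝ} (hK : IsCompact K) {ε : ℝ} (hε : 0 < ε) :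
    ∃ n₀ : ℕ, ∀ s ∈ K, ∀ n ≥ n₀,
      pmmse P X (fun ω => s * X ω + N ω) n - mmse P X (fun ω => s * X ω + N ω) ≤ ε := by
  refine hK.induction_on ⟨0, by simp⟩ ?_ ?_ fun s _ => ?_
  · rintro S T hST ⟨n, hn⟩
    exact ⟨n, fun s hs => hn s (hST hs)⟩
  · rintro S T ⟨n, hn⟩ ⟨m, hm⟩
    refine ⟨max n m, fun s hs k hk => ?_⟩
    rcases hs with hs | hs
    · exact hn s hs k (le_of_max_le_left hk)
    · exact hm s hs k (le_of_max_le_right hk)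
  · obtain ⟨n, hn⟩ := eventually_pmmse_sub_mmse_le hX hNm hX0 hN hXN s hε
    exact ⟨_, mem_nhdsWithin_of_mem_nhds hn, n, fun s hs => hs⟩

end Channel

/-- If the MGF of `X` exists on a neighborhood of `0`, then the PMMSE
converges to the MMSE uniformly in the SNR:
`sup_{t ≥ 0} (pmmse_n(X,t) - mmse(X,t)) → 0` as `n → ∞`. -/
theorem pmmse_tendsto_mmse_uniformly
    {Ω : Type*} [MeasurableSpace Ω] (P : Measure Ω) [IsProbabilityMeasure P]
    (X N : Ω → ℝ) (hXm : Measurable X) (hNm : Measurable N)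
    (hMGF : ∃ δ : ℝ, 0 < δ ∧ ∀ t ∈ Set.Ioo (-δ) δ,
      Integrable (fun ω => Real.exp (t * X ω)) P)
    (hN : Measure.map N P = gaussianReal 0 1)
    (hindep : IndepFun X N P) :
    Tendsto (fun n : ℕ => ⨆ t : Set.Ici (0 : ℝ), (pmmseAt P X N n t - mmseAt P X N t))
      atTop (nhds 0) := by
  obtain ⟨δ, hδ, hδX⟩ := hMGF
  have hX0 : 0 ∈ interior (integrableExpSet X P) := zero_mem_interior_integrableExpSet hδ hδX
  refine Metric.tendsto_atTop.2 fun ε hε => ?_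
  have hV : 0 ≤ ∫ ω, N ω ^ 2 ∂P := integral_nonneg fun _ => sq_nonneg _
  set V := ∫ ω, N ω ^ 2 ∂P
  set T := 2 * V / ε + 1
  have hT : 0 < T := by positivity
  obtain ⟨n₀, hn₀⟩ := exists_forall_pmmse_sub_mmse_le hXm hNm hX0 hN hindep
    (isCompact_Icc (a := 0) (b := √T)) (half_pos hε)
  refine ⟨max n₀ 1, fun n hn => ?_⟩
  have hnn : 0 ≤ ⨆ t : Set.Ici (0 : ℝ), (pmmseAt P X N n t - mmseAt P X N t) :=
    Real.iSup_nonneg fun t => sub_nonneg.2 (mmse_le_pmmse hXm hNm hX0 hN hindep _ n)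
  rw [Real.dist_0_eq_abs, abs_of_nonneg hnn]
  refine (Real.iSup_le (fun t => ?_) (half_pos hε).le).trans_lt (half_lt_self hε)
  rcases le_total (t : ℝ) T with h | h
  · exact hn₀ _ ⟨Real.sqrt_nonneg _, Real.sqrt_le_sqrt h⟩ n (le_of_max_le_left hn)
  · have ht : 0 < (t : ℝ) := hT.trans_le h
    refine (pmmse_sub_mmse_le_div (Real.sqrt_pos.2 ht).ne' (le_of_max_le_right hn)).trans ?_
    rw [Real.sq_sqrt ht.le, div_le_iff₀ ht]
    have h1 : 2 * V / ε * ε = 2 * V := div_mul_cancel₀ _ hε.ne'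
    have h2 : 2 * V / ε ≤ t := by linarith
    nlinarith
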